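/- Let ψ : ℝ₊ → ℝ₊ be decreasing and let m, n ∈ ℕ with m ≥ 2. The set of m×n matrices A with entries from L for which the inequality ‖qA − p‖_∞ < ψ(‖q‖_∞) has infinitely many solutions p ∈ 𝔽[X]^n, q ∈ 𝔽[X]^m with q ≠ 0 is null or full with respect to the Haar measure on L^{mn} (i.e. its intersection with I^{mn} has μ-measure 0 or 1) according as the series Σ_{r=1}^{∞} r^{m−1} ψ(r)^n converges or diverges. -/

import Mathlib

open MeasureTheory Filter Asymptotics
open scoped Classical

/-- The absolute value on `L`, the field of formal Laurent series in `X⁻¹` over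
the finite field `F` with `k = Fintype.card F` elements (here realised as
`LaurentSeries F` in the variable `t = X⁻¹`): `‖x‖ = k ^ (-order x)`, `‖0‖ = 0`. -/
noncomputable def lnorm (F : Type*) [Field F] [Fintype F] (x : LaurentSeries F) : ℝ :=
  if x = 0 then 0 else (Fintype.card F : ℝ) ^ (-x.order)

/-- The embedding of the polynomial ring `F[X]` into `L`, sending `X` to the
Laurent series with a single term of order `-1` (the element of norm `k`). -/
noncomputable def polyToL (F : Type*) [Field F] [Fintype F] (p : Polynomial F) :
    LaurentSeries F :=
  Polynomial.aeval (HahnSeries.single (-1 : ℤ) (1 : F)) p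

/-- Sup norm `‖·‖_∞` of a vector over `L`. -/
noncomputable def vnorm (F : Type*) [Field F] [Fintype F] {ι : Type*}
    (v : ι → LaurentSeries F) : ℝ :=
  ⨆ i, lnorm F (v i)

/-- Sup norm `‖·‖_∞` of a vector of polynomials, viewed inside `L`. -/
noncomputable def pvnorm (F : Type*) [Field F] [Fintype F] {ι : Type*}
    (q : ι → Polynomial F) : ℝ :=
  vnorm F fun i => polyToL F (q i)

/-- The row vector `q A ∈ L^n`, for `q ∈ F[X]^m` and an `m × n` matrix `A` over `L`. -/
noncomputable def rowMul (F : Type*) [Field F] [Fintype F] {m n : ℕ}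
    (q : Fin m → Polynomial F) (A : Fin m → Fin n → LaurentSeries F) :
    Fin n → LaurentSeries F :=
  fun j => ∑ i, polyToL F (q i) * A i j

noncomputable instance (F : Type*) [Field F] [Fintype F] :
    MeasurableSpace (LaurentSeries F) := borel _

/-- The unit ball `I^{mn}` in the space of `m × n` matrices over `L`. -/
def unitBallM (F : Type*) [Field F] [Fintype F] (m n : ℕ) :
    Set (Fin m → Fin n → LaurentSeries F) :=
  {A | ∀ i j, lnorm F (A i j) < 1}

/-- The set of `m × n` matrices `A` over `L` for which
`‖q A - p‖_∞ < ψ(‖q‖_∞)` has infinitely many solutions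
`p ∈ F[X]^n`, `q ∈ F[X]^m`, `q ≠ 0`. -/
def infSolSet (F : Type*) [Field F] [Fintype F] (m n : ℕ) (ψ : ℝ → ℝ) :
    Set (Fin m → Fin n → LaurentSeries F) :=
  {A | {qp : (Fin m → Polynomial F) × (Fin n → Polynomial F) |
      qp.1 ≠ 0 ∧
        vnorm F (fun j => rowMul F qp.1 A j - polyToL F (qp.2 j)) <
          ψ (pvnorm F qp.1)}.Infinite}

/-- Divergence half of the Borel–Cantelli lemma for pairwise independent events. -/
lemma ae_infinite_setOf_mem_of_pairwise_indep {Ω ι : Type*} [MeasurableSpace Ω] {P : Measure Ω}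
    [IsProbabilityMeasure P] {B : ι → Set Ω} (hB : ∀ i, MeasurableSet (B i))
    (hind : Pairwise fun i j => P (B i ∩ B j) = P (B i) * P (B j))
    (hsum : ¬ Summable fun i => P.real (B i)) :
    ∀ᵐ ω ∂P, {i | ω ∈ B i}.Infinite := by
  set X : ι → Ω → ℝ := fun i => (B i).indicator 1 with hX
  have hXmeas : ∀ i, Measurable (X i) := fun i => measurable_one.indicator (hB i)
  have hXL : ∀ i, MemLp (X i) 2 P := fun i =>
    memLp_indicator_const 2 (hB i) (1 : ℝ) (Or.inr (measure_ne_top _ _))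
  have hXE : ∀ i, ∫ ω, X i ω ∂P = P.real (B i) := fun i => integral_indicator_one (hB i)
  have hXvar : ∀ i, ProbabilityTheory.variance (X i) P ≤ P.real (B i) := fun i => by
    refine (ProbabilityTheory.variance_le_expectation_sq (hXmeas i).aestronglyMeasurable).trans ?_
    rw [← hXE i]
    refine le_of_eq (congrArg (fun f : Ω → ℝ => ∫ ω, f ω ∂P) (funext fun ω => ?_))
    by_cases h : ω ∈ B i <;> simp [hX, h]
  have hXind : ∀ i j, i ≠ j → ProbabilityTheory.IndepFun (X i) (X j) P := fun i j hij => by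
    have h : ProbabilityTheory.IndepSet (B i) (B j) P :=
      (ProbabilityTheory.indepSet_iff_measure_inter_eq_mul (hB i) (hB j) P).2 (hind hij)
    rw [ProbabilityTheory.IndepFun_iff_Indep]
    have hcomap : ∀ i, MeasurableSpace.comap (X i) inferInstance ≤
        MeasurableSpace.generateFrom {B i} := fun i =>
      Measurable.comap_le (@Measurable.indicator _ _ _ _
        (MeasurableSpace.generateFrom {B i}) _ _ measurable_const
        (MeasurableSpace.measurableSet_generateFrom rfl))
    exact ProbabilityTheory.indep_of_indep_of_le_left
      (ProbabilityTheory.indep_of_indep_of_le_right h (hcomap j)) (hcomap i)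
  have hnull : ∀ M : ℕ, P {ω | ∀ T : Finset ι, ∑ i ∈ T, X i ω ≤ M} = 0 := fun M => by
    have hbig : ∀ C : ℝ, ∃ T : Finset ι, C < ∑ i ∈ T, P.real (B i) := fun C => by
      by_contra! h
      exact hsum (summable_of_sum_le (fun i => measureReal_nonneg) h)
    have hle : ∀ C : ℝ, 0 < C →
        P {ω | ∀ T : Finset ι, ∑ i ∈ T, X i ω ≤ M} ≤ ENNReal.ofReal (4 / C) := fun C hC => by
      obtain ⟨T, hT⟩ := hbig (max C (2 * M))
      set E := ∑ i ∈ T, P.real (B i) with hE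
      have hEC : C < E := (le_max_left _ _).trans_lt hT
      have hEM : 2 * (M : ℝ) < E := (le_max_right _ _).trans_lt hT
      have hE0 : 0 < E := hC.trans hEC
      have hmean : ∫ ω, (∑ i ∈ T, X i) ω ∂P = E := by
        simp only [Finset.sum_apply]
        rw [integral_finsetSum _ fun i _ => (hXL i).integrable (by norm_num)]
        exact Finset.sum_congr rfl fun i _ => hXE i
      have hvar : ProbabilityTheory.variance (∑ i ∈ T, X i) P ≤ E := by
        rw [ProbabilityTheory.IndepFun.variance_sum (fun i _ => hXL i)
          (fun i _ j _ hij => hXind i j hij)]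
        exact Finset.sum_le_sum fun i _ => hXvar i
      have hcheb := ProbabilityTheory.meas_ge_le_variance_div_sq
        (memLp_finsetSum' T fun i _ => hXL i) (half_pos hE0)
      refine (measure_mono ?_).trans (hcheb.trans (ENNReal.ofReal_le_ofReal ?_))
      · intro ω hω
        have := hω T
        rw [Set.mem_ofPred_eq, hmean, Finset.sum_apply, abs_sub_comm]
        exact le_trans (by linarith) (le_abs_self _)
      · rw [div_le_div_iff₀ (by positivity) hC]
        nlinarith [mul_pos hE0 hC]
    refine le_antisymm (ge_of_tendsto (f := fun C : ℝ => ENNReal.ofReal (4 / C)) (x := atTop)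
      ?_ ?_) zero_le
    · simpa [Function.comp_def] using (ENNReal.continuous_ofReal.tendsto 0).comp
        (tendsto_const_nhds (x := (4 : ℝ)).div_atTop tendsto_id)
    · filter_upwards [eventually_gt_atTop 0] with C hC using hle C hC
  have hnull' : ∀ᵐ ω ∂P, ∀ M : ℕ, ¬ ∀ T : Finset ι, ∑ i ∈ T, X i ω ≤ M := by
    rw [ae_all_iff]
    intro M
    rw [ae_iff]
    simpa using hnull M
  filter_upwards [hnull'] with ω hω hfin
  refine hω hfin.toFinset.card fun T => ?_
  have : ∀ i, X i ω = if i ∈ hfin.toFinset then (1 : ℝ) else 0 := fun i => by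
    simp [hX, Set.indicator_apply]
  simp_rw [this]
  rw [Finset.sum_ite_mem, Finset.sum_const, nsmul_eq_mul, mul_one]
  exact_mod_cast Finset.card_le_card Finset.inter_subset_right

/-- An additive map from a subgroup `U` of measure one onto a finite group `W` pushes an
invariant measure to the uniform one. -/
lemma measure_inter_ker_of_surjOn {Ω W : Type*} [AddCommGroup Ω] [MeasurableSpace Ω]
    [MeasurableAdd Ω] (μ : Measure Ω) [μ.IsAddLeftInvariant] [AddCommGroup W] [Finite W]
    (U : AddSubgroup Ω) (hU : MeasurableSet (U : Set Ω)) (hμ : μ U = 1) (φ : Ω →+ W)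
    (hφ : ∀ w, MeasurableSet {A | φ A = w}) (hsurj : ∀ w, ∃ A ∈ U, φ A = w) :
    μ ({A | φ A = 0} ∩ U) = (Nat.card W : ENNReal)⁻¹ := by
  have hfib : ∀ w, μ ({A | φ A = w} ∩ U) = μ ({A | φ A = 0} ∩ U) := fun w => by
    obtain ⟨a, haU, ha⟩ := hsurj w
    rw [← measure_preimage_add μ a ({A | φ A = w} ∩ U)]
    congr 1
    ext A
    simp [ha, U.add_mem_cancel_left haU]
  have hunion : (U : Set Ω) = ⋃ w, {A | φ A = w} ∩ U := by
    ext A; simp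
  have hsum : (1 : ENNReal) = ∑' w, μ ({A | φ A = w} ∩ U) := by
    rw [← measure_iUnion _ fun w => (hφ w).inter hU, ← hunion, hμ]
    intro w w' hww
    refine Set.disjoint_left.2 fun A hA hA' => hww (hA.1.symm.trans hA'.1)
  have := Fintype.ofFinite W
  simp_rw [hfib] at hsum
  rw [tsum_fintype, Finset.sum_const, Finset.card_univ, nsmul_eq_mul, ← Nat.card_eq_fintype_card,
    mul_comm] at hsum
  exact ENNReal.eq_inv_of_mul_eq_one_left hsum.symm

lemma sum_Ico_one_pow_eq_sum_blocks (k : ℕ) (hk : 2 ≤ k) (f : ℕ → ℝ) (J : ℕ) :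
    ∑ r ∈ Finset.Ico 1 (k ^ J), f r =
      ∑ j ∈ Finset.range J, ∑ r ∈ Finset.Ico (k ^ j) (k ^ (j + 1)), f r := by
  induction J with
  | zero => simp
  | succ J ih =>
    rw [Finset.sum_range_succ, ← ih, Finset.sum_Ico_consecutive _ (Nat.one_le_pow _ _ (by omega))
      (Nat.pow_le_pow_right (by omega) (by omega))]

/-- Condensation along powers of `k` for the series `∑ r ^ (m - 1) * ψ r ^ n`. -/
lemma summable_pow_mul_pow_iff (k : ℕ) (hk : 2 ≤ k) (m n : ℕ) (ψ : ℝ → ℝ)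
    (hψpos : ∀ x > (0 : ℝ), 0 < ψ x) (hψdec : AntitoneOn ψ (Set.Ioi 0)) :
    (Summable fun r : ℕ => (r : ℝ) ^ (m + 1) * ψ r ^ n) ↔
      Summable fun j : ℕ => ((k : ℝ) ^ (m + 2)) ^ j * ψ ((k : ℝ) ^ j) ^ n := by
  have hk0 : (0 : ℝ) < k := by positivity
  have hkj : ∀ j : ℕ, (0 : ℝ) < (k : ℝ) ^ j := fun j => by positivity
  have hf0 : ∀ r : ℕ, 0 ≤ (r : ℝ) ^ (m + 1) * ψ r ^ n := fun r => by
    rcases Nat.eq_zero_or_pos r with rfl | hr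
    · simp
    · have := hψpos r (by positivity)
      positivity
  have hblock : ∀ j, ∀ r ∈ Finset.Ico (k ^ j) (k ^ (j + 1)),
      0 < (r : ℝ) ∧ (k : ℝ) ^ j ≤ r ∧ (r : ℝ) ≤ k ^ (j + 1) := fun j r hr => by
    rw [Finset.mem_Ico] at hr
    have h1 : (k : ℝ) ^ j ≤ r := by exact_mod_cast hr.1
    exact ⟨(hkj j).trans_le h1, h1, by exact_mod_cast hr.2.le⟩
  have hcard : ∀ j, ((Finset.Ico (k ^ j) (k ^ (j + 1))).card : ℝ) = k ^ (j + 1) - k ^ j :=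
    fun j => by
      rw [Nat.card_Ico, Nat.cast_sub (Nat.pow_le_pow_right (by omega) (by omega))]
      push_cast; ring
  have hupper : ∀ j, ∑ r ∈ Finset.Ico (k ^ j) (k ^ (j + 1)), (r : ℝ) ^ (m + 1) * ψ r ^ n ≤
      (k : ℝ) ^ (m + 2) * (((k : ℝ) ^ (m + 2)) ^ j * ψ ((k : ℝ) ^ j) ^ n) := fun j => by
    have hψj := (hψpos _ (hkj j)).le
    have : ∀ r ∈ Finset.Ico (k ^ j) (k ^ (j + 1)), (r : ℝ) ^ (m + 1) * ψ r ^ n ≤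
        ((k : ℝ) ^ (j + 1)) ^ (m + 1) * ψ ((k : ℝ) ^ j) ^ n := fun r hr => by
      obtain ⟨h0, h1, h2⟩ := hblock j r hr
      have := hψpos r h0
      have := hψdec (hkj j) h0 h1
      gcongr
    refine (Finset.sum_le_card_nsmul _ _ _ this).trans ?_
    rw [nsmul_eq_mul, hcard]
    have e : (k : ℝ) ^ (m + 2) * (((k : ℝ) ^ (m + 2)) ^ j * ψ ((k : ℝ) ^ j) ^ n) =
        (k : ℝ) ^ (j + 1) * (((k : ℝ) ^ (j + 1)) ^ (m + 1) * ψ ((k : ℝ) ^ j) ^ n) := by ring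
    rw [e]
    gcongr
    linarith [hkj j]
  have hlower : ∀ j, ((k : ℝ) ^ (m + 2)) ^ (j + 1) * ψ ((k : ℝ) ^ (j + 1)) ^ n ≤
      (k : ℝ) ^ (m + 2) *
        ∑ r ∈ Finset.Ico (k ^ j) (k ^ (j + 1)), (r : ℝ) ^ (m + 1) * ψ r ^ n := fun j => by
    have hψj := (hψpos _ (hkj (j + 1))).le
    have : ∀ r ∈ Finset.Ico (k ^ j) (k ^ (j + 1)),
        ((k : ℝ) ^ j) ^ (m + 1) * ψ ((k : ℝ) ^ (j + 1)) ^ n ≤ (r : ℝ) ^ (m + 1) * ψ r ^ n :=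
      fun r hr => by
        obtain ⟨h0, h1, h2⟩ := hblock j r hr
        have := hψpos r h0
        have := hψdec h0 (hkj (j + 1)) h2
        gcongr
    have h := Finset.card_nsmul_le_sum _ _ _ this
    rw [nsmul_eq_mul, hcard] at h
    refine le_trans ?_ (mul_le_mul_of_nonneg_left h (hkj _).le)
    have e : ((k : ℝ) ^ (m + 2)) ^ (j + 1) * ψ ((k : ℝ) ^ (j + 1)) ^ n =
        (k : ℝ) ^ (m + 2) * ((k : ℝ) ^ j *
          (((k : ℝ) ^ j) ^ (m + 1) * ψ ((k : ℝ) ^ (j + 1)) ^ n)) := by ring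
    rw [e]
    have hk2 : (2 : ℝ) ≤ k := by exact_mod_cast hk
    gcongr
    rw [pow_succ]
    nlinarith [hkj j]
  constructor
  · intro hs
    rw [← summable_nat_add_iff 1]
    refine summable_of_sum_range_le
      (c := (k : ℝ) ^ (m + 2) * ∑' r : ℕ, (r : ℝ) ^ (m + 1) * ψ r ^ n) (fun j => ?_) fun J => ?_
    · have := hψpos _ (hkj (j + 1)); positivity
    · refine (Finset.sum_le_sum fun j _ => hlower j).trans ?_
      rw [← Finset.mul_sum, ← sum_Ico_one_pow_eq_sum_blocks k hk]
      gcongr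
      exact hs.sum_le_tsum _ fun r _ => hf0 r
  · intro hs
    refine summable_of_sum_range_le
      (c := (k : ℝ) ^ (m + 2) * ∑' j : ℕ, ((k : ℝ) ^ (m + 2)) ^ j * ψ ((k : ℝ) ^ j) ^ n)
      hf0 fun J => ?_
    have hJ : ∑ r ∈ Finset.range J, (r : ℝ) ^ (m + 1) * ψ r ^ n ≤
        ∑ r ∈ Finset.Ico 1 (k ^ J), (r : ℝ) ^ (m + 1) * ψ r ^ n := by
      rw [← Finset.sum_subset (s₁ := (Finset.range J).erase 0) (Finset.erase_subset _ _)
        fun r _ hr => by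
          have : r = 0 := by simp_all
          simp [this]]
      refine Finset.sum_le_sum_of_subset_of_nonneg (fun r hr => ?_) fun r _ _ => hf0 r
      have : J < k ^ J := Nat.lt_pow_self (by omega)
      simp at hr ⊢
      omega
    refine hJ.trans ?_
    rw [sum_Ico_one_pow_eq_sum_blocks k hk]
    refine (Finset.sum_le_sum fun j _ => hupper j).trans ?_
    rw [← Finset.mul_sum]
    gcongr
    exact hs.sum_le_tsum _ fun j _ => by
      have := hψpos _ (hkj j); positivity
lemma Polynomial.card_degreeLT (F : Type*) [Field F] [Fintype F] (r : ℕ) :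
    Nat.card (Polynomial.degreeLT F r) = Fintype.card F ^ r := by
  rw [Nat.card_congr (Polynomial.degreeLTEquiv F r).toEquiv]
  simp

instance Polynomial.finite_degreeLT (F : Type*) [Field F] [Fintype F] (r : ℕ) :
    Finite (Polynomial.degreeLT F r) :=
  Finite.of_equiv _ (Polynomial.degreeLTEquiv F r).symm.toEquiv

lemma Polynomial.monic_X_pow_add_degreeLT {F : Type*} [Field F] {r : ℕ}
    (b : Polynomial.degreeLT F r) :
    (Polynomial.X ^ r + (b : Polynomial F)).Monic ∧
      (Polynomial.X ^ r + (b : Polynomial F)).natDegree = r := by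
  have hb := Polynomial.mem_degreeLT.1 b.2
  refine ⟨Polynomial.monic_X_pow_add hb, ?_⟩
  rw [Polynomial.natDegree_eq_of_degree_eq (q := Polynomial.X ^ r)
    (Polynomial.degree_add_eq_left_of_degree_lt (by simpa using hb))]
  simp

/-- Splitting off a monic greatest common divisor. -/
lemma Polynomial.exists_monic_mul_coprime {F : Type*} [Field F] (a b : Polynomial F)
    (hb : b.Monic) :
    ∃ d a' b' : Polynomial F, d.Monic ∧ b'.Monic ∧ IsCoprime a' b' ∧ a = d * a' ∧ b = d * b' := by
  have hg : EuclideanDomain.gcd a b ≠ 0 := fun h =>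
    hb.ne_zero (EuclideanDomain.gcd_eq_zero_iff.1 h).2
  obtain ⟨a', ha'⟩ := EuclideanDomain.gcd_dvd_left a b
  obtain ⟨b', hb'⟩ := EuclideanDomain.gcd_dvd_right a b
  set g := EuclideanDomain.gcd a b with hgdef
  have hcop : IsCoprime a' b' := by
    refine ⟨EuclideanDomain.gcdA a b, EuclideanDomain.gcdB a b, mul_left_cancel₀ hg ?_⟩
    have := EuclideanDomain.gcd_eq_gcd_ab a b
    rw [← hgdef] at this
    linear_combination -this - EuclideanDomain.gcdA a b * ha' - EuclideanDomain.gcdB a b * hb'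
  have hl : g.leadingCoeff ≠ 0 := Polynomial.leadingCoeff_ne_zero.2 hg
  have hu : (Polynomial.C g.leadingCoeff⁻¹ * Polynomial.C g.leadingCoeff : Polynomial F) = 1 := by
    rw [← Polynomial.C_mul, inv_mul_cancel₀ hl, Polynomial.C_1]
  have hdm : (g * Polynomial.C g.leadingCoeff⁻¹).Monic := Polynomial.monic_mul_leadingCoeff_inv hg
  have hbe : b = g * Polynomial.C g.leadingCoeff⁻¹ * (Polynomial.C g.leadingCoeff * b') := by
    rw [mul_assoc, ← mul_assoc (Polynomial.C _), hu, one_mul]; exact hb'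
  refine ⟨g * Polynomial.C g.leadingCoeff⁻¹, Polynomial.C g.leadingCoeff * a',
    Polynomial.C g.leadingCoeff * b', hdm, hdm.of_mul_monic_left (hbe ▸ hb), ?_, ?_, hbe⟩
  · have hunit : IsUnit (Polynomial.C g.leadingCoeff : Polynomial F) :=
      Polynomial.isUnit_C.2 hl.isUnit
    exact (isCoprime_mul_unit_left hunit a' b').2 hcop
  · rw [mul_assoc, ← mul_assoc (Polynomial.C _), hu, one_mul]; exact ha'

lemma Polynomial.eq_of_mul_coprime_eq {F : Type*} [Field F] {d e a b a' b' : Polynomial F}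
    (hd : d.Monic) (he : e.Monic) (h : IsCoprime a b) (h' : IsCoprime a' b')
    (ha : d * a = e * a') (hb : d * b = e * b') : d = e := by
  refine Polynomial.eq_of_monic_of_associated hd he (associated_of_dvd_dvd ?_ ?_)
  · obtain ⟨u, v, huv⟩ := h'
    exact ⟨u * a + v * b, by linear_combination -e * huv - u * ha - v * hb⟩
  · obtain ⟨u, v, huv⟩ := h
    exact ⟨u * a' + v * b', by linear_combination -d * huv + u * ha + v * hb⟩

lemma Polynomial.monic_divX {F : Type*} [Field F] {d : Polynomial F} (hd : d.Monic)
    (h : d.natDegree ≠ 0) : d.divX.Monic := by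
  rw [Polynomial.Monic, Polynomial.leadingCoeff, Polynomial.natDegree_divX_eq_natDegree_tsub_one,
    Polynomial.coeff_divX, Nat.sub_add_cancel (Nat.pos_of_ne_zero h)]
  exact hd

/-- At least half of the pairs `(a, b)` with `b` monic of degree `r + 1` and `deg a ≤ r` are
coprime: dividing the greatest common divisor by `X` maps the other pairs into pairs of lower
degree, with fibres indexed by the constant coefficient. -/
lemma Polynomial.card_pow_le_two_mul_card_coprime (F : Type*) [Field F] [Fintype F] (r : ℕ) :
    (Fintype.card F) ^ (2 * (r + 1)) ≤
      2 * Nat.card {x : Polynomial.degreeLT F (r + 1) × Polynomial.degreeLT F (r + 1) //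
        IsCoprime (x.1 : Polynomial F) (Polynomial.X ^ (r + 1) + (x.2 : Polynomial F))} := by
  set p : Polynomial.degreeLT F (r + 1) × Polynomial.degreeLT F (r + 1) → Prop := fun x =>
    IsCoprime (x.1 : Polynomial F) (Polynomial.X ^ (r + 1) + (x.2 : Polynomial F)) with hp
  have htotal : (Fintype.card F) ^ (2 * (r + 1)) =
      Nat.card {x // p x} + Nat.card {x // ¬ p x} := by
    rw [← Nat.card_sum, Nat.card_congr (Equiv.sumCompl p), Nat.card_prod,
      Polynomial.card_degreeLT]
    ring
  have hnon : Nat.card {x // ¬ p x} ≤ Fintype.card F ^ (2 * r + 1) := by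
    have key : ∀ x : {x // ¬ p x}, ∃ d a' b' : Polynomial F, d.Monic ∧ b'.Monic ∧
        IsCoprime a' b' ∧ (x.1.1 : Polynomial F) = d * a' ∧
        Polynomial.X ^ (r + 1) + (x.1.2 : Polynomial F) = d * b' := fun x =>
      Polynomial.exists_monic_mul_coprime _ _ (Polynomial.monic_X_pow_add_degreeLT x.1.2).1
    choose d a b hd hb hcop hda hdb using key
    have hdeg : ∀ x, (d x).natDegree ≠ 0 := fun x h => by
      have h1 : d x = 1 := (hd x).natDegree_eq_zero.1 h
      apply x.2
      simp only [hp]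
      rw [hda x, hdb x, h1, one_mul, one_mul]
      exact hcop x
    have hem : ∀ x, (d x).divX.Monic := fun x => Polynomial.monic_divX (hd x) (hdeg x)
    have hsucc : ∀ x, (d x).degree = 1 + (d x).divX.degree := fun x => by
      rw [Polynomial.degree_eq_natDegree (hd x).ne_zero,
        Polynomial.degree_eq_natDegree (hem x).ne_zero,
        Polynomial.natDegree_divX_eq_natDegree_tsub_one]
      have := hdeg x
      norm_cast
      omega
    have ha_mem : ∀ x, (d x).divX * a x ∈ Polynomial.degreeLT F r := fun x => by
      rw [Polynomial.mem_degreeLT]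
      have h := Polynomial.mem_degreeLT.1 x.1.1.2
      rw [hda x, Polynomial.degree_mul, hsucc, add_assoc, ← Polynomial.degree_mul] at h
      cases hc : ((d x).divX * a x).degree with
      | bot => exact WithBot.bot_lt_coe _
      | coe c =>
        rw [hc] at h
        have h' : 1 + c < r + 1 := WithBot.coe_lt_coe.1 h
        exact WithBot.coe_lt_coe.2 (show c < r by omega)
    have hb_mem : ∀ x, (d x).divX * b x - Polynomial.X ^ r ∈ Polynomial.degreeLT F r := fun x => by
      have hm : ((d x).divX * b x).Monic := (hem x).mul (hb x)
      have hdg : ((d x).divX * b x).degree = r := by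
        have h := (Polynomial.monic_X_pow_add_degreeLT x.1.2).2
        rw [hdb x, (hd x).natDegree_mul (hb x)] at h
        rw [Polynomial.degree_eq_natDegree hm.ne_zero, (hem x).natDegree_mul (hb x),
          Polynomial.natDegree_divX_eq_natDegree_tsub_one]
        have := hdeg x
        norm_cast
        omega
      rw [Polynomial.mem_degreeLT, ← hdg]
      exact Polynomial.degree_sub_lt_left (by simp [hdg]) hm.ne_zero (by simp [hm.leadingCoeff])
    let f : {x // ¬ p x} → F × Polynomial.degreeLT F r × Polynomial.degreeLT F r := fun x =>
      ((d x).coeff 0, ⟨_, ha_mem x⟩, ⟨_, hb_mem x⟩)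
    have hf : Function.Injective f := fun x y hxy => by
      simp only [f, Prod.mk.injEq, Subtype.mk.injEq, sub_left_inj] at hxy
      obtain ⟨h0, h1, h2⟩ := hxy
      have he : (d x).divX = (d y).divX :=
        Polynomial.eq_of_mul_coprime_eq (hem x) (hem y) (hcop x) (hcop y) h1 h2
      have hdd : d x = d y := by
        rw [← Polynomial.divX_mul_X_add (d x), ← Polynomial.divX_mul_X_add (d y), he, h0]
      rw [he] at h1 h2
      have h1' := mul_left_cancel₀ (hem y).ne_zero h1
      have h2' := mul_left_cancel₀ (hem y).ne_zero h2
      refine Subtype.ext (Prod.ext (Subtype.ext ?_) (Subtype.ext ?_))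
      · rw [hda x, hda y, hdd, h1']
      · have := (hdb x).trans ((congrArg₂ (· * ·) hdd h2').trans (hdb y).symm)
        exact add_left_cancel this
    refine (Nat.card_le_card_of_injective f hf).trans (le_of_eq ?_)
    rw [Nat.card_prod, Nat.card_prod, Polynomial.card_degreeLT, Nat.card_eq_fintype_card]
    ring
  have h2 : 2 * Fintype.card F ^ (2 * r + 1) ≤ Fintype.card F ^ (2 * (r + 1)) := by
    have : 2 ≤ Fintype.card F := Fintype.one_lt_card
    calc 2 * Fintype.card F ^ (2 * r + 1) ≤ Fintype.card F * Fintype.card F ^ (2 * r + 1) := by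
          gcongr
      _ = _ := by ring
  change _ ≤ 2 * Nat.card {x // p x}
  omega

/-- Parameters of a vector in `F[X]^(m+2)` of degree `r` whose first two entries are coprime, whose
second entry is monic of degree `r`, and whose remaining entries have degree less than `r`. -/
abbrev PrimitiveIndex (F : Type*) [Field F] (m r : ℕ) : Type _ :=
  {x : Polynomial.degreeLT F r × Polynomial.degreeLT F r //
    IsCoprime (x.1 : Polynomial F) (Polynomial.X ^ r + (x.2 : Polynomial F))} ×
  (Fin m → Polynomial.degreeLT F r)

/-- The vector with given parameters. -/
noncomputable def primitiveVec {F : Type*} [Field F] {m r : ℕ} (x : PrimitiveIndex F m r) :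
    Fin (m + 2) → Polynomial F :=
  Fin.cons (x.1.1.1 : Polynomial F)
    (Fin.cons (Polynomial.X ^ r + (x.1.1.2 : Polynomial F)) fun i => (x.2 i : Polynomial F))

lemma card_pow_le_two_mul_card_primitiveIndex (F : Type*) [Field F] [Fintype F] (m r : ℕ) :
    ((Fintype.card F) ^ (m + 2)) ^ (r + 1) ≤ 2 * Nat.card (PrimitiveIndex F m (r + 1)) := by
  rw [Nat.card_prod, Nat.card_pi]
  simp only [Polynomial.card_degreeLT, Finset.prod_const, Finset.card_univ, Fintype.card_fin]
  rw [← mul_assoc]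
  refine le_trans (le_of_eq ?_)
    (Nat.mul_le_mul_right _ (Polynomial.card_pow_le_two_mul_card_coprime F r))
  ring

/-- Distinct primitive vectors are not proportional. -/
lemma exists_minor_primitiveVec_ne_zero {F : Type*} [Field F] {m : ℕ}
    {x y : Σ r, PrimitiveIndex F m r} (hxy : x ≠ y) :
    ∃ l l', primitiveVec x.2 l * primitiveVec y.2 l' - primitiveVec x.2 l' * primitiveVec y.2 l
      ≠ 0 := by
  contrapose! hxy
  obtain ⟨r, ⟨⟨a, b⟩, hab⟩, c⟩ := x
  obtain ⟨s, ⟨⟨a', b'⟩, hab'⟩, c'⟩ := y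
  obtain ⟨hm, hr⟩ := Polynomial.monic_X_pow_add_degreeLT b
  obtain ⟨hm', hs⟩ := Polynomial.monic_X_pow_add_degreeLT b'
  have h01 := sub_eq_zero.1 (hxy 0 1)
  have h1 : ∀ i : Fin m, _ := fun i => sub_eq_zero.1 (hxy 1 i.succ.succ)
  simp only [primitiveVec, Fin.cons_zero, Fin.cons_one, Fin.cons_succ] at h01 h1 hab hab'
  have hB : Polynomial.X ^ r + (b : Polynomial F) = Polynomial.X ^ s + (b' : Polynomial F) := by
    refine Polynomial.eq_of_monic_of_associated hm hm' (associated_of_dvd_dvd ?_ ?_)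
    · exact hab.symm.dvd_of_dvd_mul_left ⟨_, h01⟩
    · exact hab'.symm.dvd_of_dvd_mul_left ⟨a, by rw [mul_comm (a' : Polynomial F), ← h01, mul_comm]⟩
  obtain rfl : r = s := by rw [← hr, ← hs, hB]
  obtain rfl : b = b' := Subtype.ext (add_left_cancel hB)
  obtain rfl : a = a' := Subtype.ext
    (mul_right_cancel₀ hm.ne_zero (h01.trans (mul_comm _ _)))
  obtain rfl : c = c' := funext fun i => Subtype.ext
    (mul_left_cancel₀ hm.ne_zero ((mul_comm _ _).trans (h1 i).symm))
  rfl

lemma primitiveVec_one_ne_zero {F : Type*} [Field F] {m r : ℕ} (x : PrimitiveIndex F m r) :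
    primitiveVec x 1 ≠ 0 :=
  (Polynomial.monic_X_pow_add_degreeLT x.1.1.2).1.ne_zero

lemma natDegree_primitiveVec_one {F : Type*} [Field F] {m r : ℕ} (x : PrimitiveIndex F m r) :
    (primitiveVec x 1).natDegree = r :=
  (Polynomial.monic_X_pow_add_degreeLT x.1.1.2).2

lemma natDegree_primitiveVec_le {F : Type*} [Field F] {m r : ℕ} (x : PrimitiveIndex F m r)
    (l : Fin (m + 2)) : (primitiveVec x l).natDegree ≤ r := by
  have hlt : ∀ b : Polynomial.degreeLT F r, (b : Polynomial F).natDegree ≤ r := fun b =>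
    Polynomial.natDegree_le_of_degree_le (Polynomial.mem_degreeLT.1 b.2).le
  induction l using Fin.cases with
  | zero => exact hlt _
  | succ l =>
    induction l using Fin.cases with
    | zero => exact (Polynomial.monic_X_pow_add_degreeLT x.1.1.2).2.le
    | succ l => exact hlt _
section LaurentNorm

variable {F : Type*} [Field F] [Fintype F]

lemma one_lt_card_real (F : Type*) [Field F] [Fintype F] : (1 : ℝ) < Fintype.card F := by
  exact_mod_cast Fintype.one_lt_card (α := F)

lemma lnorm_lt_iff {c : ℝ} {s : ℤ} (h1 : (Fintype.card F : ℝ) ^ (-s) < c)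
    (h2 : c ≤ (Fintype.card F : ℝ) ^ (-s + 1)) (x : LaurentSeries F) :
    lnorm F x < c ↔ ∀ i < s, x.coeff i = 0 := by
  have hk := one_lt_card_real F
  by_cases hx : x = 0
  · simp only [lnorm, hx, if_true, HahnSeries.coeff_zero, implies_true, iff_true]
    exact (zpow_pos (by linarith) _).trans h1
  rw [lnorm, if_neg hx]
  constructor
  · intro h i hi
    refine HahnSeries.coeff_eq_zero_of_lt_order (hi.trans_le ?_)
    by_contra! hlt
    have := zpow_le_zpow_right₀ hk.le (show -s + 1 ≤ -x.order by omega)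
    linarith
  · intro h
    have hs : s ≤ x.order := by
      by_contra! hlt
      exact hx (HahnSeries.coeff_order_eq_zero.1 (h _ hlt))
    exact (zpow_le_zpow_right₀ hk.le (by omega)).trans_lt h1

lemma lnorm_lt_one_iff (x : LaurentSeries F) : lnorm F x < 1 ↔ ∀ i ≤ 0, x.coeff i = 0 := by
  have hk := one_lt_card_real F
  rw [lnorm_lt_iff (s := 1) (by simpa using inv_lt_one_of_one_lt₀ hk) (by simp)]
  simp only [Int.lt_iff_add_one_le, add_le_iff_nonpos_left]

lemma polyToL_mul (p q : Polynomial F) : polyToL F (p * q) = polyToL F p * polyToL F q :=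
  map_mul _ p q

lemma polyToL_sub (p q : Polynomial F) : polyToL F (p - q) = polyToL F p - polyToL F q :=
  map_sub _ p q

lemma polyToL_sum {ι : Type*} (s : Finset ι) (p : ι → Polynomial F) :
    polyToL F (∑ i ∈ s, p i) = ∑ i ∈ s, polyToL F (p i) :=
  map_sum _ p s

lemma coeff_polyToL (p : Polynomial F) (i : ℤ) :
    (polyToL F p).coeff i = if i ≤ 0 then p.coeff (-i).toNat else 0 := by
  induction p using Polynomial.induction_on' with
  | add p q hp hq =>
    have : polyToL F (p + q) = polyToL F p + polyToL F q := map_add _ p q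
    rw [this, HahnSeries.coeff_add, hp, hq]
    split_ifs <;> simp
  | monomial n a =>
    have : polyToL F (Polynomial.monomial n a) = HahnSeries.single (-n : ℤ) a := by
      rw [polyToL, Polynomial.aeval_monomial, HahnSeries.single_pow, LaurentSeries.algebraMap_apply]
      simp [HahnSeries.C_apply]
    rw [this, HahnSeries.coeff_single, Polynomial.coeff_monomial]
    split_ifs <;> first | rfl | omega

lemma coeff_polyToL_neg (p : Polynomial F) (d : ℕ) : (polyToL F p).coeff (-d) = p.coeff d := by
  simp [coeff_polyToL]

lemma coeff_polyToL_of_pos (p : Polynomial F) {i : ℤ} (hi : 0 < i) :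
    (polyToL F p).coeff i = 0 := by
  rw [coeff_polyToL, if_neg (not_le.2 hi)]

lemma polyToL_ne_zero {p : Polynomial F} (hp : p ≠ 0) : polyToL F p ≠ 0 := fun h => by
  apply Polynomial.leadingCoeff_ne_zero.2 hp
  rw [Polynomial.leadingCoeff, ← coeff_polyToL_neg, h, HahnSeries.coeff_zero]

lemma lnorm_polyToL {p : Polynomial F} (hp : p ≠ 0) :
    lnorm F (polyToL F p) = (Fintype.card F : ℝ) ^ p.natDegree := by
  have h0 := polyToL_ne_zero hp
  have : (polyToL F p).order = -(p.natDegree : ℤ) := by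
    refine le_antisymm (HahnSeries.order_le_of_coeff_ne_zero ?_) ?_
    · rw [coeff_polyToL_neg]
      exact Polynomial.leadingCoeff_ne_zero.2 hp
    · by_contra! hlt
      apply h0
      rw [← HahnSeries.coeff_order_eq_zero, coeff_polyToL, if_pos (by omega)]
      exact Polynomial.coeff_eq_zero_of_natDegree_lt (by omega)
  rw [lnorm, if_neg h0, this, neg_neg, zpow_natCast]

lemma vnorm_lt_iff {ι : Type*} [Finite ι] [Nonempty ι] (v : ι → LaurentSeries F) (c : ℝ) :
    vnorm F v < c ↔ ∀ i, lnorm F (v i) < c := by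
  constructor
  · exact fun h i => (le_ciSup (Set.finite_range _).bddAbove i).trans_lt h
  · intro h
    obtain ⟨i, hi⟩ := exists_eq_ciSup_of_finite (f := fun i => lnorm F (v i))
    rw [vnorm, ← hi]
    exact h i

lemma pvnorm_eq_pow {ι : Type*} [Finite ι] (q : ι → Polynomial F) (r : ℕ)
    (hle : ∀ l, (q l).natDegree ≤ r) (l : ι) (hl : q l ≠ 0) (hlr : (q l).natDegree = r) :
    pvnorm F q = (Fintype.card F : ℝ) ^ r := by
  have hk := one_lt_card_real F
  have : Nonempty ι := ⟨l⟩
  refine le_antisymm (ciSup_le fun i => ?_) ?_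
  · by_cases hi : q i = 0
    · have : polyToL F (q i) = 0 := by rw [hi]; exact map_zero _
      simp only [this, lnorm, if_true]
      positivity
    · rw [lnorm_polyToL hi]
      exact pow_le_pow_right₀ hk.le (hle i)
  · rw [← hlr, ← lnorm_polyToL hl]
    exact le_ciSup (f := fun i => lnorm F (polyToL F (q i))) (Set.finite_range _).bddAbove l

/-- Every Laurent series in `X⁻¹` is a polynomial up to an element of the unit ball. -/
lemma exists_polynomial_part (x : LaurentSeries F) :
    ∃ p : Polynomial F, ∀ i ≤ 0, (x - polyToL F p).coeff i = 0 := by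
  refine ⟨∑ d ∈ Finset.range ((-x.order).toNat + 1), Polynomial.monomial d (x.coeff (-d)),
    fun i hi => ?_⟩
  obtain ⟨d, rfl⟩ : ∃ d : ℕ, i = -d := ⟨(-i).toNat, by omega⟩
  rw [HahnSeries.coeff_sub, coeff_polyToL_neg, Polynomial.finsetSum_coeff]
  simp only [Polynomial.coeff_monomial, Finset.sum_ite_eq', Finset.mem_range]
  split_ifs with h
  · simp
  · rw [sub_zero]
    exact HahnSeries.coeff_eq_zero_of_lt_order (by omega)

lemma finite_setOf_coeff_sub_polyToL_eq_zero (x : LaurentSeries F) (s : ℤ) :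
    {p : Polynomial F | ∀ i < s, (x - polyToL F p).coeff i = 0}.Finite := by
  have hfin := Polynomial.finite_degreeLT F ((max (-s) (-x.order)).toNat + 1)
  refine Set.Finite.subset (s := (Polynomial.degreeLT F ((max (-s) (-x.order)).toNat + 1) :
    Set (Polynomial F))) hfin fun p hp => ?_
  rw [SetLike.mem_coe, Polynomial.mem_degreeLT, Polynomial.degree_lt_iff_coeff_zero]
  intro d hd
  have h := hp (-d) (by omega)
  rw [HahnSeries.coeff_sub, coeff_polyToL_neg,
    HahnSeries.coeff_eq_zero_of_lt_order (by omega), zero_sub, neg_eq_zero] at h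
  exact h

end LaurentNorm

section RowCoeff

variable {F : Type*} [Field F] [Fintype F] {m n : ℕ}

/-- The first `t` coefficients of the fractional parts of the entries of `q A`. -/
noncomputable def rowCoeff (q : Fin m → Polynomial F) (t : ℕ) :
    (Fin m → Fin n → LaurentSeries F) →+ (Fin n → Fin t → F) where
  toFun A := fun j i => (rowMul F q A j).coeff ((i : ℤ) + 1)
  map_zero' := by
    ext j i
    simp [rowMul]
  map_add' A B := by
    ext j i
    simp only [rowMul, Pi.add_apply, mul_add, Finset.sum_add_distrib, HahnSeries.coeff_add]

lemma rowCoeff_apply (q : Fin m → Polynomial F) (t : ℕ) (A : Fin m → Fin n → LaurentSeries F)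
    (j : Fin n) (i : Fin t) : rowCoeff q t A j i = (rowMul F q A j).coeff ((i : ℤ) + 1) := rfl

lemma exists_vnorm_rowMul_sub_lt_iff (hn : 1 ≤ n) {c : ℝ} {s : ℤ}
    (h1 : (Fintype.card F : ℝ) ^ (-s) < c) (h2 : c ≤ (Fintype.card F : ℝ) ^ (-s + 1))
    (q : Fin m → Polynomial F) (A : Fin m → Fin n → LaurentSeries F) :
    (∃ p : Fin n → Polynomial F, vnorm F (fun j => rowMul F q A j - polyToL F (p j)) < c) ↔
      rowCoeff q (s - 1).toNat A = 0 := by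
  have : Nonempty (Fin n) := ⟨⟨0, hn⟩⟩
  simp only [vnorm_lt_iff, lnorm_lt_iff h1 h2]
  constructor
  · rintro ⟨p, hp⟩
    ext j i
    have h := hp j ((i : ℤ) + 1) (by omega)
    rwa [HahnSeries.coeff_sub, coeff_polyToL_of_pos _ (by omega), sub_zero] at h
  · intro h
    choose p hp using fun j => exists_polynomial_part (rowMul F q A j)
    refine ⟨p, fun j i hi => ?_⟩
    rcases le_or_gt i 0 with h0 | h0
    · exact hp j i h0
    · rw [HahnSeries.coeff_sub, coeff_polyToL_of_pos _ h0, sub_zero]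
      have := congrFun (congrFun h j) ⟨(i - 1).toNat, by omega⟩
      rw [rowCoeff_apply] at this
      convert! this using 2
      simp only
      omega

variable (F m n) in
/-- The unit ball as an additive subgroup. -/
def unitBallSubgroup : AddSubgroup (Fin m → Fin n → LaurentSeries F) where
  carrier := unitBallM F m n
  zero_mem' := fun i j => (lnorm_lt_one_iff _).2 fun _ _ => rfl
  add_mem' := fun {A B} hA hB i j => (lnorm_lt_one_iff _).2 fun d hd => by
    rw [Pi.add_apply, Pi.add_apply, HahnSeries.coeff_add, (lnorm_lt_one_iff _).1 (hA i j) d hd,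
      (lnorm_lt_one_iff _).1 (hB i j) d hd, add_zero]
  neg_mem' := fun {A} hA i j => (lnorm_lt_one_iff _).2 fun d hd => by
    rw [Pi.neg_apply, Pi.neg_apply, HahnSeries.coeff_neg, (lnorm_lt_one_iff _).1 (hA i j) d hd,
      neg_zero]

lemma exists_mem_unitBall_rowCoeff_eq (A : Fin m → Fin n → LaurentSeries F) :
    ∃ A' ∈ unitBallSubgroup F m n, ∀ (q : Fin m → Polynomial F) (t : ℕ),
      rowCoeff q t A' = rowCoeff q t A := by
  choose P hP using fun i j => exists_polynomial_part (A i j)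
  refine ⟨fun i j => A i j - polyToL F (P i j), fun i j => (lnorm_lt_one_iff _).2 (hP i j),
    fun q t => ?_⟩
  ext j i
  have : rowMul F q (fun i j => A i j - polyToL F (P i j)) j =
      rowMul F q A j - polyToL F (∑ l, q l * P l j) := by
    simp only [rowMul, mul_sub, Finset.sum_sub_distrib, polyToL_sum, polyToL_mul]
  rw [rowCoeff_apply, rowCoeff_apply, this, HahnSeries.coeff_sub,
    coeff_polyToL_of_pos _ (by omega), sub_zero]

/-- There is a Laurent series with prescribed coefficients in degrees `1, …, t`. -/
lemma exists_coeff_eq {K : Type*} [Field K] {t : ℕ} (w : Fin t → K) :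
    ∃ x : LaurentSeries K, ∀ i : Fin t, x.coeff ((i : ℤ) + 1) = w i := by
  refine ⟨∑ i : Fin t, HahnSeries.single ((i : ℤ) + 1) (w i), fun i => ?_⟩
  rw [HahnSeries.coeff_sum, Finset.sum_eq_single i]
  · simp
  · intro b _ hb
    rw [HahnSeries.coeff_single_of_ne]
    intro h
    exact hb (Fin.ext (by omega))
  · simp

lemma rowCoeff_surjOn_unitBall {q : Fin m → Polynomial F} (hq : q ≠ 0) (t : ℕ)
    (w : Fin n → Fin t → F) : ∃ A ∈ unitBallSubgroup F m n, rowCoeff q t A = w := by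
  obtain ⟨l, hl⟩ := Function.ne_iff.1 hq
  choose u hu using fun j => exists_coeff_eq (w j)
  obtain ⟨A, hA, h⟩ := exists_mem_unitBall_rowCoeff_eq
    (fun i j => if i = l then u j / polyToL F (q l) else 0)
  refine ⟨A, hA, (h q t).trans ?_⟩
  ext j i
  rw [rowCoeff_apply, rowMul, Finset.sum_eq_single l (fun b _ hb => by simp [hb]) (by simp),
    if_pos rfl, mul_div_cancel₀ _ (polyToL_ne_zero hl), hu]

lemma rowCoeff_prod_surjOn_unitBall {q q' : Fin m → Polynomial F} {l l' : Fin m}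
    (hq : q l * q' l' - q l' * q' l ≠ 0) (t t' : ℕ)
    (w : (Fin n → Fin t → F) × (Fin n → Fin t' → F)) :
    ∃ A ∈ unitBallSubgroup F m n, ((rowCoeff q t).prod (rowCoeff q' t')) A = w := by
  have hll : l ≠ l' := by
    rintro rfl
    exact hq (sub_self _)
  choose u hu using fun j => exists_coeff_eq (w.1 j)
  choose u' hu' using fun j => exists_coeff_eq (w.2 j)
  have hD := polyToL_ne_zero hq
  rw [polyToL_sub, polyToL_mul, polyToL_mul] at hD
  obtain ⟨A, hA, h⟩ := exists_mem_unitBall_rowCoeff_eq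
    (fun i j => if i = l then
        (polyToL F (q' l') * u j - polyToL F (q l') * u' j) /
          (polyToL F (q l) * polyToL F (q' l') - polyToL F (q l') * polyToL F (q' l))
      else if i = l' then
        (polyToL F (q l) * u' j - polyToL F (q' l) * u j) /
          (polyToL F (q l) * polyToL F (q' l') - polyToL F (q l') * polyToL F (q' l))
      else 0)
  refine ⟨A, hA, Prod.ext ((h q t).trans ?_) ((h q' t').trans ?_)⟩
  · ext j i
    rw [rowCoeff_apply, rowMul, Fintype.sum_eq_add l l' hll fun b hb => by simp [hb.1, hb.2],
      if_pos rfl, if_neg hll.symm, if_pos rfl, ← hu]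
    congr 1
    rw [mul_div_assoc', mul_div_assoc', ← add_div, div_eq_iff hD]
    ring
  · ext j i
    rw [rowCoeff_apply, rowMul, Fintype.sum_eq_add l l' hll fun b hb => by simp [hb.1, hb.2],
      if_pos rfl, if_neg hll.symm, if_pos rfl, ← hu']
    congr 1
    rw [mul_div_assoc', mul_div_assoc', ← add_div, div_eq_iff hD]
    ring

end RowCoeff

section Measure

variable {F : Type*} [Field F] [Fintype F] {m n : ℕ}

instance (F : Type*) [Field F] [Fintype F] : BorelSpace (LaurentSeries F) := ⟨rfl⟩

lemma measurableSet_setOf_coeff_eq (d : ℤ) (a : F) :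
    MeasurableSet {x : LaurentSeries F | x.coeff d = a} := by
  let _ : UniformSpace F := ⊥
  have : DiscreteTopology F := ⟨rfl⟩
  exact ((isOpen_discrete {a}).preimage
    (LaurentSeries.uniformContinuous_coeff (K := F) d).continuous).measurableSet

lemma measurable_coeff [MeasurableSpace F] [MeasurableSingletonClass F] (d : ℤ) :
    Measurable fun x : LaurentSeries F => x.coeff d :=
  measurable_to_countable' fun a => measurableSet_setOf_coeff_eq d a

lemma measurableSet_unitBall :
    MeasurableSet (unitBallSubgroup F m n : Set (Fin m → Fin n → LaurentSeries F)) := by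
  have : (unitBallSubgroup F m n : Set (Fin m → Fin n → LaurentSeries F)) =
      ⋂ (i) (j) (d : ℤ) (_ : d ≤ 0), {A | (A i j).coeff d = 0} := by
    ext A
    simp only [Set.mem_iInter]
    exact forall₂_congr fun i j => lnorm_lt_one_iff _
  rw [this]
  refine .iInter fun i => .iInter fun j => .iInter fun d => .iInter fun _ => ?_
  have h : Measurable fun A : Fin m → Fin n → LaurentSeries F => A i j :=
    (measurable_pi_apply j).comp (measurable_pi_apply i)
  exact h (measurableSet_setOf_coeff_eq d 0)

lemma measurableSet_setOf_rowCoeff_eq (q : Fin m → Polynomial F) (t : ℕ) (w : Fin n → Fin t → F) :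
    MeasurableSet {A | rowCoeff q t A = w} := by
  let _ : MeasurableSpace F := ⊤
  have hmeas : ∀ j (d : ℤ), Measurable fun A : Fin m → Fin n → LaurentSeries F =>
      (rowMul F q A j).coeff d := fun j d => by
    simp only [rowMul, HahnSeries.coeff_sum]
    refine Finset.measurable_sum _ fun i _ => (measurable_coeff d).comp ?_
    exact (continuous_const_mul _).measurable.comp
      ((measurable_pi_apply j).comp (measurable_pi_apply i))
  have : {A | rowCoeff q t A = w} =
      ⋂ (j) (i : Fin t), {A | (rowMul F q A j).coeff ((i : ℤ) + 1) = w j i} := by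
    ext A
    simp only [Set.mem_iInter]
    exact funext_iff.trans (forall_congr' fun j => funext_iff)
  rw [this]
  exact .iInter fun j => .iInter fun i => hmeas j _ (measurableSet_singleton _)

variable (μ : Measure (Fin m → Fin n → LaurentSeries F)) [μ.IsAddHaarMeasure]

lemma measure_rowCoeff_eq_zero (hμ : μ (unitBallM F m n) = 1) {q : Fin m → Polynomial F}
    (hq : q ≠ 0) (t : ℕ) :
    μ ({A | rowCoeff q t A = 0} ∩ unitBallM F m n) =
      (((Fintype.card F ^ t) ^ n : ℕ) : ENNReal)⁻¹ := by
  have h := measure_inter_ker_of_surjOn μ (unitBallSubgroup F m n) measurableSet_unitBall hμ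
    (rowCoeff q t) (measurableSet_setOf_rowCoeff_eq q t) (rowCoeff_surjOn_unitBall hq t)
  rwa [Nat.card_eq_fintype_card, Fintype.card_fun, Fintype.card_fun, Fintype.card_fin,
    Fintype.card_fin] at h

lemma measure_rowCoeff_inter (hμ : μ (unitBallM F m n) = 1) {q q' : Fin m → Polynomial F}
    {l l' : Fin m} (hq : q l * q' l' - q l' * q' l ≠ 0) (t t' : ℕ) :
    μ (({A | rowCoeff q t A = 0} ∩ {A | rowCoeff q' t' A = 0}) ∩ unitBallM F m n) =
      (((Fintype.card F ^ t) ^ n : ℕ) : ENNReal)⁻¹ *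
        (((Fintype.card F ^ t') ^ n : ℕ) : ENNReal)⁻¹ := by
  have hset : ∀ w : (Fin n → Fin t → F) × (Fin n → Fin t' → F),
      {A : Fin m → Fin n → LaurentSeries F | ((rowCoeff q t).prod (rowCoeff q' t')) A = w} =
        {A | rowCoeff q t A = w.1} ∩ {A | rowCoeff q' t' A = w.2} := fun w => by
    ext A
    exact Prod.ext_iff
  have h := measure_inter_ker_of_surjOn μ (unitBallSubgroup F m n) measurableSet_unitBall hμ
    ((rowCoeff q t).prod (rowCoeff q' t'))
    (fun w => hset w ▸ (measurableSet_setOf_rowCoeff_eq q t w.1).inter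
      (measurableSet_setOf_rowCoeff_eq q' t' w.2))
    (rowCoeff_prod_surjOn_unitBall hq t t')
  rw [hset] at h
  rw [Nat.card_prod, Nat.card_eq_fintype_card, Nat.card_eq_fintype_card, Fintype.card_fun,
    Fintype.card_fun, Fintype.card_fun, Fintype.card_fun, Fintype.card_fin,
    Fintype.card_fin, Fintype.card_fin] at h
  rw [← ENNReal.mul_inv (Or.inr (ENNReal.natCast_ne_top _)) (Or.inl (ENNReal.natCast_ne_top _)),
    ← Nat.cast_mul]
  exact h

end Measure

section MainTheorem

variable {F : Type*} [Field F] [Fintype F] {m n : ℕ}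

/-- The discretised approximation threshold: `‖x‖ < ψ(k ^ r)` means that the coefficients of `x`
of index below `s r` vanish. -/
lemma exists_threshold (ψ : ℝ → ℝ) (hψpos : ∀ x > (0 : ℝ), 0 < ψ x) :
    ∃ s : ℕ → ℤ, ∀ r, (Fintype.card F : ℝ) ^ (-s r) < ψ ((Fintype.card F : ℝ) ^ r) ∧
      ψ ((Fintype.card F : ℝ) ^ r) ≤ (Fintype.card F : ℝ) ^ (-s r + 1) := by
  have hk := one_lt_card_real F
  choose u hu using fun r : ℕ =>
    exists_mem_Ioc_zpow (hψpos ((Fintype.card F : ℝ) ^ r) (by positivity)) hk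
  exact ⟨fun r => -u r, fun r => by simpa using hu r⟩

lemma inv_pow_toNat_le {c : ℝ} {s : ℤ} (h : (Fintype.card F : ℝ) ^ (-s) < c) :
    ((Fintype.card F : ℝ) ^ (s - 1).toNat)⁻¹ ≤ Fintype.card F * c := by
  have hk := one_lt_card_real F
  have hk0 : (0 : ℝ) < Fintype.card F := by linarith
  rw [← zpow_natCast, ← zpow_neg]
  calc (Fintype.card F : ℝ) ^ (-((s - 1).toNat : ℤ)) ≤ (Fintype.card F : ℝ) ^ (1 + -s) :=
        zpow_le_zpow_right₀ hk.le (by omega)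
    _ = Fintype.card F * (Fintype.card F : ℝ) ^ (-s) := by rw [zpow_add₀ hk0.ne', zpow_one]
    _ ≤ _ := by gcongr

lemma min_one_le_inv_pow_toNat {k c : ℝ} {s : ℤ} (h : c ≤ k ^ (-s + 1)) :
    min 1 c ≤ (k ^ (s - 1).toNat)⁻¹ := by
  rcases le_total s 1 with hs | hs
  · rw [Int.toNat_of_nonpos (by omega)]
    simp
  · refine (min_le_right _ _).trans (h.trans (le_of_eq ?_))
    rw [← zpow_natCast, ← zpow_neg]
    congr 1
    omega

/-- If only finitely many degrees `r` admit a solution vector `q`, there are finitely many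
solutions. -/
lemma frequently_of_mem_infSolSet (hn : 1 ≤ n) {ψ : ℝ → ℝ} {s : ℕ → ℤ}
    (hs : ∀ r, (Fintype.card F : ℝ) ^ (-s r) < ψ ((Fintype.card F : ℝ) ^ r) ∧
      ψ ((Fintype.card F : ℝ) ^ r) ≤ (Fintype.card F : ℝ) ^ (-s r + 1))
    {A : Fin m → Fin n → LaurentSeries F} (hA : A ∈ infSolSet F m n ψ) :
    ∃ᶠ r in atTop, ∃ x : Fin m → Polynomial.degreeLT F (r + 1),
      (fun l => (x l : Polynomial F)) ≠ 0 ∧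
        rowCoeff (fun l => (x l : Polynomial F)) (s r - 1).toNat A = 0 := by
  have : Nonempty (Fin n) := ⟨⟨0, hn⟩⟩
  by_contra hev
  rw [not_frequently, eventually_atTop] at hev
  obtain ⟨R, hR⟩ := hev
  apply hA
  have hfinq : {q : Fin m → Polynomial F | ∀ l, q l ∈ Polynomial.degreeLT F R}.Finite :=
    Set.Finite.pi' fun _ => Polynomial.finite_degreeLT F R
  have hpv : ∀ q : Fin m → Polynomial F, q ≠ 0 → ∃ r : ℕ,
      (∀ l, (q l).natDegree ≤ r) ∧ pvnorm F q = (Fintype.card F : ℝ) ^ r := fun q hq => by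
    obtain ⟨l₀, hl₀⟩ := Function.ne_iff.1 hq
    obtain ⟨l, hl, hmax⟩ := Finset.exists_max_image (Finset.univ.filter fun l => q l ≠ 0)
      (fun l => (q l).natDegree) ⟨l₀, by simpa using hl₀⟩
    have hle : ∀ l', (q l').natDegree ≤ (q l).natDegree := fun l' => by
      by_cases h : q l' = 0
      · simp [h]
      · exact hmax l' (by simpa using h)
    exact ⟨_, hle, pvnorm_eq_pow q _ hle l (by simpa using hl) rfl⟩
  refine (hfinq.biUnion (t := fun q => {qp : (Fin m → Polynomial F) × (Fin n → Polynomial F) |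
    qp.1 = q ∧ q ≠ 0 ∧ vnorm F (fun j => rowMul F q A j - polyToL F (qp.2 j)) <
      ψ (pvnorm F q)}) fun q _ => ?_).subset ?_
  · by_cases hq : q = 0
    · simp [hq]
    obtain ⟨r, -, hr⟩ := hpv q hq
    have hp : {p : Fin n → Polynomial F | ∀ j, p j ∈
        {p : Polynomial F | ∀ i < s r, (rowMul F q A j - polyToL F p).coeff i = 0}}.Finite :=
      Set.Finite.pi' fun j => finite_setOf_coeff_sub_polyToL_eq_zero _ _
    refine ((Set.finite_singleton q).prod hp).subset ?_
    rintro ⟨q', p⟩ ⟨h1, -, h2⟩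
    refine ⟨h1, fun j => ?_⟩
    rw [hr, vnorm_lt_iff] at h2
    exact (lnorm_lt_iff (hs r).1 (hs r).2 _).1 (h2 j)
  · rintro ⟨q, p⟩ ⟨hq, hlt⟩
    obtain ⟨r, hle, hr⟩ := hpv q hq
    refine Set.mem_biUnion (x := q) ?_ ⟨rfl, hq, hlt⟩
    have hmem : ∀ l, q l ∈ Polynomial.degreeLT F (r + 1) := fun l => by
      rw [Polynomial.mem_degreeLT]
      exact (Polynomial.degree_le_of_natDegree_le (hle l)).trans_lt
        (by exact_mod_cast Nat.lt_succ_self r)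
    have hrR : r < R := by
      by_contra! h
      refine hR r h ⟨fun l => ⟨q l, hmem l⟩, hq, ?_⟩
      rw [← exists_vnorm_rowMul_sub_lt_iff hn (hs r).1 (hs r).2, ← hr]
      exact ⟨p, hlt⟩
    exact fun l => Polynomial.degreeLT_mono hrR (hmem l)

variable (μ : Measure (Fin m → Fin n → LaurentSeries F)) [μ.IsAddHaarMeasure]

/-- Convergence half of the theorem. -/
lemma measure_infSolSet_eq_zero (hn : 1 ≤ n) (ψ : ℝ → ℝ) (hψpos : ∀ x > (0 : ℝ), 0 < ψ x)
    (hμ : μ (unitBallM F m n) = 1)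
    (hsum : Summable fun r : ℕ =>
      ((Fintype.card F : ℝ) ^ m) ^ r * ψ ((Fintype.card F : ℝ) ^ r) ^ n) :
    μ (infSolSet F m n ψ ∩ unitBallM F m n) = 0 := by
  obtain ⟨s, hs⟩ := exists_threshold (F := F) ψ hψpos
  have hk := one_lt_card_real F
  let p : ℕ → (Fin m → Fin n → LaurentSeries F) → Prop := fun r A =>
    (∃ x : Fin m → Polynomial.degreeLT F (r + 1), (fun l => (x l : Polynomial F)) ≠ 0 ∧
      rowCoeff (fun l => (x l : Polynomial F)) (s r - 1).toNat A = 0) ∧ A ∈ unitBallM F m n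
  have hsub : infSolSet F m n ψ ∩ unitBallM F m n ⊆ {A | ∃ᶠ r in atTop, p r A} := fun A hA =>
    (frequently_of_mem_infSolSet hn hs hA.1).mono fun r hr => ⟨hr, hA.2⟩
  refine measure_mono_null hsub (measure_setOfPred_frequently_eq_zero ?_)
  have hbound : ∀ r, μ {A | p r A} ≤ ENNReal.ofReal
      (((Fintype.card F : ℝ) ^ m * (Fintype.card F : ℝ) ^ n) *
        (((Fintype.card F : ℝ) ^ m) ^ r * ψ ((Fintype.card F : ℝ) ^ r) ^ n)) := fun r => by
    have hfin := Fintype.ofFinite (Fin m → Polynomial.degreeLT F (r + 1))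
    have hψr := hψpos ((Fintype.card F : ℝ) ^ r) (by positivity)
    set t := (s r - 1).toNat with ht
    have hsub' : {A | p r A} ⊆ ⋃ x : Fin m → Polynomial.degreeLT F (r + 1),
        {A | (fun l => (x l : Polynomial F)) ≠ 0 ∧
          A ∈ {A | rowCoeff (fun l => (x l : Polynomial F)) t A = 0} ∩ unitBallM F m n} := by
      rintro A ⟨⟨x, hx, h⟩, hA⟩
      exact Set.mem_iUnion.2 ⟨x, hx, h, hA⟩
    calc μ {A | p r A} ≤ _ := measure_mono hsub'
      _ ≤ ∑ x : Fin m → Polynomial.degreeLT F (r + 1),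
          (((Fintype.card F ^ t) ^ n : ℕ) : ENNReal)⁻¹ := by
        refine (measure_iUnion_fintype_le _ _).trans (Finset.sum_le_sum fun x _ => ?_)
        by_cases hx : (fun l => (x l : Polynomial F)) = 0
        · simp [hx]
        · rw [← measure_rowCoeff_eq_zero μ hμ hx t]
          exact measure_mono fun A hA => hA.2
      _ = ENNReal.ofReal (((Fintype.card F : ℝ) ^ (r + 1)) ^ m *
            (((Fintype.card F : ℝ) ^ t)⁻¹) ^ n) := by
        rw [Finset.sum_const, Finset.card_univ, ← Nat.card_eq_fintype_card, Nat.card_pi,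
          nsmul_eq_mul]
        simp only [Polynomial.card_degreeLT, Finset.prod_const, Finset.card_univ, Fintype.card_fin]
        rw [ENNReal.ofReal_mul (by positivity), inv_pow, ENNReal.ofReal_inv_of_pos (by positivity)]
        congr 1
        · rw [← ENNReal.ofReal_natCast]; push_cast; rfl
        · rw [← ENNReal.ofReal_natCast]; push_cast; rfl
      _ ≤ _ := by
        refine ENNReal.ofReal_le_ofReal ?_
        have h := inv_pow_toNat_le (hs r).1
        rw [← ht] at h
        calc ((Fintype.card F : ℝ) ^ (r + 1)) ^ m * (((Fintype.card F : ℝ) ^ t)⁻¹) ^ n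
            ≤ ((Fintype.card F : ℝ) ^ (r + 1)) ^ m *
              (Fintype.card F * ψ ((Fintype.card F : ℝ) ^ r)) ^ n := by gcongr
          _ = _ := by rw [mul_pow]; ring
  refine ne_top_of_le_ne_top ?_ (ENNReal.tsum_le_tsum hbound)
  exact (hsum.mul_left _).tsum_ofReal_ne_top

end MainTheorem

/-- The total measure of the events attached to primitive vectors diverges. -/
lemma not_summable_primitiveIndex {F : Type*} [Field F] [Fintype F] {m n : ℕ}
    {ψ : ℝ → ℝ} (hψpos : ∀ x > (0 : ℝ), 0 < ψ x) {s : ℕ → ℤ}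
    (hs : ∀ r, ψ ((Fintype.card F : ℝ) ^ r) ≤ (Fintype.card F : ℝ) ^ (-s r + 1))
    (hsum : ¬ Summable fun r : ℕ =>
      ((Fintype.card F : ℝ) ^ (m + 2)) ^ r * ψ ((Fintype.card F : ℝ) ^ r) ^ n) :
    ¬ Summable fun i : Σ r, PrimitiveIndex F m r =>
      (((Fintype.card F : ℝ) ^ (s i.1 - 1).toNat)⁻¹) ^ n := fun hsm => by
  apply hsum
  have hk := one_lt_card_real F
  have hsm' := ((summable_sigma_of_nonneg fun i => by positivity).1 hsm).2
  have hmin : Summable fun r : ℕ => ((Fintype.card F : ℝ) ^ (m + 2)) ^ r *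
      min 1 (ψ ((Fintype.card F : ℝ) ^ r)) ^ n := by
    rw [← summable_nat_add_iff 1] at hsm' ⊢
    have hmin0 : ∀ r : ℕ, 0 ≤ min 1 (ψ ((Fintype.card F : ℝ) ^ r)) := fun r =>
      le_min zero_le_one (hψpos _ (by positivity)).le
    refine Summable.of_nonneg_of_le (fun r => ?_) (fun r => ?_) (hsm'.mul_left 2)
    · have := hmin0 (r + 1)
      positivity
    · have hcard : ((Fintype.card F : ℝ) ^ (m + 2)) ^ (r + 1) ≤
          2 * (Nat.card (PrimitiveIndex F m (r + 1)) : ℝ) := by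
        exact_mod_cast card_pow_le_two_mul_card_primitiveIndex F m r
      have hle := min_one_le_inv_pow_toNat (hs (r + 1))
      have := hmin0 (r + 1)
      simp only [tsum_const, nsmul_eq_mul]
      rw [← mul_assoc]
      gcongr
  refine hmin.congr_atTop ?_
  filter_upwards [hmin.tendsto_atTop_zero.eventually_lt_const one_pos] with r hr
  congr 2
  refine min_eq_right ?_
  by_contra! h
  rw [min_eq_left h.le, one_pow, mul_one] at hr
  exact absurd hr (not_lt.2 (one_le_pow₀ (one_le_pow₀ hk.le)))

/-- A matrix lying in infinitely many of the events attached to primitive vectors has infinitely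
many approximations. -/
lemma mem_infSolSet_of_infinite {F : Type*} [Field F] [Fintype F] {m n : ℕ} (hn : 1 ≤ n)
    {ψ : ℝ → ℝ} {s : ℕ → ℤ}
    (hs : ∀ r, (Fintype.card F : ℝ) ^ (-s r) < ψ ((Fintype.card F : ℝ) ^ r) ∧
      ψ ((Fintype.card F : ℝ) ^ r) ≤ (Fintype.card F : ℝ) ^ (-s r + 1))
    {A : Fin (m + 2) → Fin n → LaurentSeries F}
    (hA : {i : Σ r, PrimitiveIndex F m r |
      rowCoeff (primitiveVec i.2) (s i.1 - 1).toNat A = 0}.Infinite) :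
    A ∈ infSolSet F (m + 2) n ψ := by
  have hsol : ∀ i : Σ r, PrimitiveIndex F m r,
      rowCoeff (primitiveVec i.2) (s i.1 - 1).toNat A = 0 → ∃ p : Fin n → Polynomial F,
        vnorm F (fun j => rowMul F (primitiveVec i.2) A j - polyToL F (p j)) <
          ψ (pvnorm F (primitiveVec i.2)) := fun i hi => by
    rw [pvnorm_eq_pow _ i.1 (natDegree_primitiveVec_le i.2) 1 (primitiveVec_one_ne_zero i.2)
      (natDegree_primitiveVec_one i.2)]
    exact (exists_vnorm_rowMul_sub_lt_iff hn (hs i.1).1 (hs i.1).2 _ _).2 hi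
  choose! p hp using hsol
  have hmaps : Set.MapsTo (fun i : Σ r, PrimitiveIndex F m r => (primitiveVec i.2, p i))
      {i | rowCoeff (primitiveVec i.2) (s i.1 - 1).toNat A = 0}
      {qp | qp.1 ≠ 0 ∧ vnorm F (fun j => rowMul F qp.1 A j - polyToL F (qp.2 j)) <
        ψ (pvnorm F qp.1)} := fun i hi =>
    ⟨fun h => primitiveVec_one_ne_zero i.2 (congrFun h 1), hp i hi⟩
  refine Set.infinite_of_injOn_mapsTo ?_ hmaps hA
  intro i _ j _ hij
  by_contra hne
  obtain ⟨l, l', hll⟩ := exists_minor_primitiveVec_ne_zero hne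
  rw [(Prod.mk.inj hij).1] at hll
  exact hll (by ring)

/-- Divergence half of the theorem. -/
lemma measure_infSolSet_eq_one {F : Type*} [Field F] [Fintype F] {m n : ℕ}
    (μ : Measure (Fin (m + 2) → Fin n → LaurentSeries F)) [μ.IsAddHaarMeasure] (hn : 1 ≤ n)
    (ψ : ℝ → ℝ) (hψpos : ∀ x > (0 : ℝ), 0 < ψ x) (hμ : μ (unitBallM F (m + 2) n) = 1)
    (hsum : ¬ Summable fun r : ℕ =>
      ((Fintype.card F : ℝ) ^ (m + 2)) ^ r * ψ ((Fintype.card F : ℝ) ^ r) ^ n) :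
    μ (infSolSet F (m + 2) n ψ ∩ unitBallM F (m + 2) n) = 1 := by
  obtain ⟨s, hs⟩ := exists_threshold (F := F) ψ hψpos
  have hU : MeasurableSet (unitBallM F (m + 2) n) := measurableSet_unitBall
  set P := μ.restrict (unitBallM F (m + 2) n) with hP
  have hprob : IsProbabilityMeasure P := ⟨by rw [hP, Measure.restrict_apply_univ, hμ]⟩
  have hne : ∀ i : Σ r, PrimitiveIndex F m r, primitiveVec i.2 ≠ 0 := fun i h =>
    primitiveVec_one_ne_zero i.2 (congrFun h 1)
  let B : (Σ r, PrimitiveIndex F m r) → Set (Fin (m + 2) → Fin n → LaurentSeries F) := fun i =>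
    {A | rowCoeff (primitiveVec i.2) (s i.1 - 1).toNat A = 0}
  have hB : ∀ i, MeasurableSet (B i) := fun i => measurableSet_setOf_rowCoeff_eq _ _ _
  have hPB : ∀ i, P (B i) =
      (((Fintype.card F ^ (s i.1 - 1).toNat) ^ n : ℕ) : ENNReal)⁻¹ := fun i => by
    rw [hP, Measure.restrict_apply (hB i)]
    exact measure_rowCoeff_eq_zero μ hμ (hne i) _
  have hPBreal : ∀ i, P.real (B i) = (((Fintype.card F : ℝ) ^ (s i.1 - 1).toNat)⁻¹) ^ n :=
    fun i => by
      rw [measureReal_def, hPB, ENNReal.toReal_inv, ENNReal.toReal_natCast, inv_pow]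
      push_cast
      rfl
  have hind : Pairwise fun i j => P (B i ∩ B j) = P (B i) * P (B j) := fun i j hij => by
    obtain ⟨l, l', hll⟩ := exists_minor_primitiveVec_ne_zero hij
    simp only [hPB]
    rw [hP, Measure.restrict_apply ((hB i).inter (hB j))]
    exact measure_rowCoeff_inter μ hμ hll _ _
  have hdiv : ¬ Summable fun i => P.real (B i) := by
    simp only [hPBreal]
    exact not_summable_primitiveIndex hψpos (fun r => (hs r).2) hsum
  have hae : ∀ᵐ A ∂P, A ∈ infSolSet F (m + 2) n ψ := by
    filter_upwards [ae_infinite_setOf_mem_of_pairwise_indep hB hind hdiv] with A hA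
    exact mem_infSolSet_of_infinite hn hs hA
  rw [hP, ae_restrict_iff' hU] at hae
  rw [← hμ]
  refine measure_congr ?_
  filter_upwards [hae] with A hA
  exact propext ⟨fun h => h.2, fun h => ⟨hA h, h⟩⟩

/-- **Khintchine–Groshev theorem over a field of formal series**
(Kristensen, Theorem 3).  Let `ψ : ℝ₊ → ℝ₊` be decreasing and `m ≥ 2`, `n ≥ 1`.
The set of `m × n` matrices `A` over `L` such that `‖q A - p‖_∞ < ψ(‖q‖_∞)`
has infinitely many solutions `p ∈ F[X]^n`, `q ∈ F[X]^m ∖ {0}`, is null or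
full with respect to the Haar measure `μ` (normalised so the unit ball has
measure `1`) according as `∑ r^{m-1} ψ(r)^n` converges or diverges. -/
theorem khintchine_groshev_zero_one
    {F : Type*} [Field F] [Fintype F]
    (m n : ℕ) (hm : 2 ≤ m) (hn : 1 ≤ n)
    (ψ : ℝ → ℝ) (hψpos : ∀ x > (0 : ℝ), 0 < ψ x)
    (hψdec : AntitoneOn ψ (Set.Ioi 0))
    (μ : Measure (Fin m → Fin n → LaurentSeries F)) [μ.IsAddHaarMeasure]
    (hμ : μ (unitBallM F m n) = 1) :
    (Summable (fun r : ℕ => (r : ℝ) ^ (m - 1) * ψ r ^ n) →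
      μ (infSolSet F m n ψ ∩ unitBallM F m n) = 0) ∧
    (¬ Summable (fun r : ℕ => (r : ℝ) ^ (m - 1) * ψ r ^ n) →
      μ (infSolSet F m n ψ ∩ unitBallM F m n) = 1) := by
  obtain ⟨m, rfl⟩ : ∃ m', m = m' + 2 := ⟨m - 2, by omega⟩
  have hiff := summable_pow_mul_pow_iff (Fintype.card F) (Fintype.one_lt_card (α := F)) m n ψ
    hψpos hψdec
  rw [show m + 2 - 1 = m + 1 by omega, hiff]
  exact ⟨measure_infSolSet_eq_zero μ hn ψ hψpos hμ, measure_infSolSet_eq_one μ hn ψ hψpos hμ⟩
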